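/- Fix a classifier g. If the divergence measure d(·||·) is jointly convex in its two arguments, then the classification risk–domain discrepancy function T(Δ) = inf { d(p^(u)(Y,Z) || p^(s)(Y,Z)) : representations f with seen-domain classification risk C^(s)(f,g) ≤ Δ } is monotonically non-increasing in Δ and convex in Δ (on the set of thresholds Δ for which the constraint set is nonempty). -/

import Mathlib

open Finset

/-- A probability distribution on a finite type. -/
def IsProb {α : Type*} [Fintype α] (p : α → ℝ) : Prop :=
  (∀ a, 0 ≤ p a) ∧ ∑ a, p a = 1

/-- A joint probability distribution on the product of two finite types (curried form). -/
def IsJoint {α β : Type*} [Fintype α] [Fintype β] (p : α → β → ℝ) : Prop :=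
  (∀ a b, 0 ≤ p a b) ∧ ∑ a, ∑ b, p a b = 1

/-- A (possibly randomized) representation: a Markov kernel from `α` to `β`. -/
def IsKernel {α β : Type*} [Fintype α] [Fintype β] (f : α → β → ℝ) : Prop :=
  (∀ a b, 0 ≤ f a b) ∧ ∀ a, ∑ b, f a b = 1

/-- A conditional distribution on `β` given a point of `α`. -/
def IsCond {α β : Type*} [Fintype α] [Fintype β] (p : α → β → ℝ) : Prop :=
  ∀ a, IsProb (p a)

/-- The joint distribution on inputs and representations induced by a data
distribution `pX` and a representation kernel `f`. -/
def jointXZ {𝒳 𝒵 : Type*} [Fintype 𝒳] [Fintype 𝒵]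
    (pX : 𝒳 → ℝ) (f : 𝒳 → 𝒵 → ℝ) : 𝒳 → 𝒵 → ℝ :=
  fun x z => pX x * f x z

/-- The joint label–representation distribution on `𝒴 × 𝒵` obtained from the
conditional label distribution `pYX` and a joint input–representation
distribution `q` via the Markov chain `Y → X → Z`. -/
def jointYZ {𝒳 𝒵 𝒴 : Type*} [Fintype 𝒳] [Fintype 𝒵] [Fintype 𝒴]
    (pYX : 𝒳 → 𝒴 → ℝ) (q : 𝒳 → 𝒵 → ℝ) : 𝒴 → 𝒵 → ℝ :=
  fun y z => ∑ x, pYX x y * q x z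

/-- The seen-domain classification risk under a joint input–representation
distribution `q`, classifier `g`, loss `ℓ` and labeling function `ys`. -/
def risk {𝒳 𝒵 𝒴 : Type*} [Fintype 𝒳] [Fintype 𝒵] [Fintype 𝒴]
    (q : 𝒳 → 𝒵 → ℝ) (g : 𝒵 → 𝒴) (ℓ : 𝒴 → 𝒴 → ℝ) (ys : 𝒳 → 𝒴) : ℝ :=
  ∑ x, ∑ z, q x z * ℓ (g z) (ys x)

theorem setOf_isKernel_eq_pi_stdSimplex (α β : Type*) [Fintype α] [Fintype β] :
    {f : α → β → ℝ | IsKernel f} = Set.univ.pi fun _ => stdSimplex ℝ β := by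
  ext f
  simp only [Set.mem_ofPred_eq, Set.mem_pi, Set.mem_univ, true_implies, IsKernel, stdSimplex,
    forall_and]

/-- Every kernel is a mixture of deterministic kernels, so a convex function of the kernel is
bounded above. -/
theorem ConvexOn.bddAbove_image_isKernel {α β : Type*} [Fintype α] [Fintype β]
    {F : (α → β → ℝ) → ℝ} (hF : ConvexOn ℝ {f | IsKernel f} F) :
    BddAbove (F '' {f | IsKernel f}) := by
  classical
  set V : Set (α → β → ℝ) :=
    Set.univ.pi fun _ => Set.range fun i j : β => if i = j then (1 : ℝ) else 0
  have hV : convexHull ℝ V = {f | IsKernel f} := by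
    rw [setOf_isKernel_eq_pi_stdSimplex, convexHull_pi]
    simp only [convexHull_basis_eq_stdSimplex]
  have hfin : V.Finite := Set.Finite.pi fun _ => Set.finite_range _
  rw [← hV] at hF ⊢
  exact hF.bddAbove_convexHull (subset_convexHull ℝ V) (hfin.image F).bddAbove

/-- The uniform kernel is a mixture, with fixed weights, of any given kernel and another one, so a
convex function of the kernel is bounded below. -/
theorem ConvexOn.bddBelow_image_isKernel {α β : Type*} [Fintype α] [Fintype β]
    {F : (α → β → ℝ) → ℝ} (hF : ConvexOn ℝ {f | IsKernel f} F) :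
    BddBelow (F '' {f | IsKernel f}) := by
  rcases isEmpty_or_nonempty β with hβ | hβ
  · exact ((Set.toFinite {f : α → β → ℝ | IsKernel f}).image F).bddBelow
  obtain ⟨M, hM⟩ := hF.bddAbove_image_isKernel
  set n : ℝ := (Fintype.card β : ℝ) with hn
  have hn0 : 0 < n := by rw [hn]; exact_mod_cast Fintype.card_pos
  refine ⟨(n + 1) * F (fun _ _ => 1 / n) - n * M, ?_⟩
  rintro _ ⟨f, hf, rfl⟩
  have hf1 : ∀ a b, f a b ≤ 1 := fun a b =>
    (hf.2 a) ▸ Finset.single_le_sum (fun b _ => hf.1 a b) (Finset.mem_univ b)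
  set f' : α → β → ℝ := fun a b => ((n + 1) / n - f a b) / n with hf'
  have hker : IsKernel f' := by
    refine ⟨fun a b => div_nonneg ?_ hn0.le, fun a => ?_⟩
    · have : (1 : ℝ) ≤ (n + 1) / n := by rw [le_div_iff₀ hn0]; linarith
      linarith [hf1 a b]
    · simp only [hf', ← Finset.sum_div, Finset.sum_sub_distrib, hf.2 a, Finset.sum_const,
        Finset.card_univ, nsmul_eq_mul, ← hn]
      field_simp
      ring
  have hmix : (1 / (n + 1)) • f + (n / (n + 1)) • f' = fun _ _ => 1 / n := by
    funext a b
    simp only [hf', Pi.add_apply, Pi.smul_apply, smul_eq_mul]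
    field_simp
    ring
  have hconv := hF.2 hf hker (show 0 ≤ 1 / (n + 1) by positivity)
    (show 0 ≤ n / (n + 1) by positivity) (by field_simp; ring)
  rw [hmix, smul_eq_mul, smul_eq_mul, div_mul_eq_mul_div, div_mul_eq_mul_div, ← add_div,
    le_div_iff₀ (by positivity)] at hconv
  nlinarith [mul_le_mul_of_nonneg_left (hM ⟨f', hker, rfl⟩) hn0.le]

theorem convex_setOf_isKernel (α β : Type*) [Fintype α] [Fintype β] :
    Convex ℝ {f : α → β → ℝ | IsKernel f} := by
  rw [setOf_isKernel_eq_pi_stdSimplex]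
  exact convex_pi fun _ _ => convex_stdSimplex ℝ β

theorem isJoint_jointYZ_jointXZ {𝒳 𝒵 𝒴 : Type*} [Fintype 𝒳] [Fintype 𝒵] [Fintype 𝒴]
    {pX : 𝒳 → ℝ} (hp : IsProb pX) {pYX : 𝒳 → 𝒴 → ℝ} (hpY : IsCond pYX)
    {f : 𝒳 → 𝒵 → ℝ} (hf : IsKernel f) : IsJoint (jointYZ pYX (jointXZ pX f)) := by
  refine ⟨fun y z => Finset.sum_nonneg fun x _ =>
    mul_nonneg ((hpY x).1 y) (mul_nonneg (hp.1 x) (hf.1 x z)), ?_⟩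
  calc ∑ y, ∑ z, ∑ x, pYX x y * (pX x * f x z)
      = ∑ y, ∑ x, ∑ z, pYX x y * (pX x * f x z) :=
        Finset.sum_congr rfl fun y _ => Finset.sum_comm
    _ = ∑ x, ∑ y, ∑ z, pYX x y * (pX x * f x z) := Finset.sum_comm
    _ = ∑ x, pX x := Finset.sum_congr rfl fun x _ => by
        simp only [← Finset.mul_sum, hf.2 x, mul_one]
        rw [← Finset.sum_mul, (hpY x).2, one_mul]
    _ = 1 := hp.2

theorem jointYZ_jointXZ_mix {𝒳 𝒵 𝒴 : Type*} [Fintype 𝒳] [Fintype 𝒵] [Fintype 𝒴]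
    (pX : 𝒳 → ℝ) (pYX : 𝒳 → 𝒴 → ℝ) (f₁ f₂ : 𝒳 → 𝒵 → ℝ) (a b : ℝ) :
    jointYZ pYX (jointXZ pX (a • f₁ + b • f₂)) = fun y z =>
      a * jointYZ pYX (jointXZ pX f₁) y z + b * jointYZ pYX (jointXZ pX f₂) y z := by
  funext y z
  simp only [jointYZ, jointXZ, Pi.add_apply, Pi.smul_apply, smul_eq_mul, Finset.mul_sum,
    ← Finset.sum_add_distrib]
  exact Finset.sum_congr rfl fun x _ => by ring

theorem risk_jointXZ_mix {𝒳 𝒵 𝒴 : Type*} [Fintype 𝒳] [Fintype 𝒵] [Fintype 𝒴]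
    (pX : 𝒳 → ℝ) (g : 𝒵 → 𝒴) (ℓ : 𝒴 → 𝒴 → ℝ) (ys : 𝒳 → 𝒴) (f₁ f₂ : 𝒳 → 𝒵 → ℝ) (a b : ℝ) :
    risk (jointXZ pX (a • f₁ + b • f₂)) g ℓ ys =
      a * risk (jointXZ pX f₁) g ℓ ys + b * risk (jointXZ pX f₂) g ℓ ys := by
  simp only [risk, jointXZ, Pi.add_apply, Pi.smul_apply, smul_eq_mul, Finset.mul_sum,
    ← Finset.sum_add_distrib]
  exact Finset.sum_congr rfl fun x _ => Finset.sum_congr rfl fun z _ => by ring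

/-- **Trade-off between classification risk and domain discrepancy.**
For a fixed classifier `g`, if the divergence `d` is jointly convex then the
classification risk–domain discrepancy function
`T(Δ) = inf { d(p⁽ᵘ⁾(Y,Z) ‖ p⁽ˢ⁾(Y,Z)) : C⁽ˢ⁾(f,g) ≤ Δ }`
is monotonically non-increasing and convex on the set of thresholds for which
the constraint set is nonempty. -/
theorem tradeoff_antitone_and_convex
    {𝒳 𝒵 𝒴 : Type*} [Fintype 𝒳] [Fintype 𝒵] [Fintype 𝒴]
    (pSX pUX : 𝒳 → ℝ) (hpS : IsProb pSX) (hpU : IsProb pUX)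
    (pSYX pUYX : 𝒳 → 𝒴 → ℝ) (hpSY : IsCond pSYX) (hpUY : IsCond pUYX)
    (g : 𝒵 → 𝒴) (ℓ : 𝒴 → 𝒴 → ℝ) (hℓ : ∀ y y', 0 ≤ ℓ y y') (ys : 𝒳 → 𝒴)
    (d : (𝒴 → 𝒵 → ℝ) → (𝒴 → 𝒵 → ℝ) → ℝ)
    (hd : ∀ a₁ a₂ b₁ b₂ : 𝒴 → 𝒵 → ℝ, IsJoint a₁ → IsJoint a₂ → IsJoint b₁ →
      IsJoint b₂ → ∀ lam : ℝ, 0 ≤ lam → lam ≤ 1 →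
        d (fun y z => lam * a₁ y z + (1 - lam) * a₂ y z)
          (fun y z => lam * b₁ y z + (1 - lam) * b₂ y z)
          ≤ lam * d a₁ b₁ + (1 - lam) * d a₂ b₂)
    (T : ℝ → ℝ)
    (hT : ∀ Δ : ℝ, T Δ = sInf {r : ℝ | ∃ f : 𝒳 → 𝒵 → ℝ, IsKernel f ∧
      risk (jointXZ pSX f) g ℓ ys ≤ Δ ∧
      r = d (jointYZ pUYX (jointXZ pUX f)) (jointYZ pSYX (jointXZ pSX f))}) :
    (∀ Δ₁ Δ₂ : ℝ, Δ₁ ≤ Δ₂ →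
      (∃ f : 𝒳 → 𝒵 → ℝ, IsKernel f ∧ risk (jointXZ pSX f) g ℓ ys ≤ Δ₁) →
      T Δ₂ ≤ T Δ₁) ∧
    (∀ Δ₁ Δ₂ lam : ℝ, 0 ≤ lam → lam ≤ 1 →
      (∃ f : 𝒳 → 𝒵 → ℝ, IsKernel f ∧ risk (jointXZ pSX f) g ℓ ys ≤ Δ₁) →
      (∃ f : 𝒳 → 𝒵 → ℝ, IsKernel f ∧ risk (jointXZ pSX f) g ℓ ys ≤ Δ₂) →
      T (lam * Δ₁ + (1 - lam) * Δ₂) ≤ lam * T Δ₁ + (1 - lam) * T Δ₂) := by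
  set F : (𝒳 → 𝒵 → ℝ) → ℝ := fun f =>
    d (jointYZ pUYX (jointXZ pUX f)) (jointYZ pSYX (jointXZ pSX f)) with hFdef
  have hF : ConvexOn ℝ {f | IsKernel f} F := by
    refine ⟨convex_setOf_isKernel 𝒳 𝒵, fun f₁ h₁ f₂ h₂ a b ha hb hab => ?_⟩
    obtain rfl : b = 1 - a := by linarith
    simp only [hFdef, jointYZ_jointXZ_mix, smul_eq_mul]
    exact hd _ _ _ _ (isJoint_jointYZ_jointXZ hpU hpUY h₁) (isJoint_jointYZ_jointXZ hpU hpUY h₂)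
      (isJoint_jointYZ_jointXZ hpS hpSY h₁) (isJoint_jointYZ_jointXZ hpS hpSY h₂) a ha
      (by linarith)
  have hbdd : ∀ Δ : ℝ, BddBelow {r : ℝ | ∃ f : 𝒳 → 𝒵 → ℝ, IsKernel f ∧
      risk (jointXZ pSX f) g ℓ ys ≤ Δ ∧ r = F f} := fun Δ =>
    hF.bddBelow_image_isKernel.mono <| by
      rintro _ ⟨f, hf, -, rfl⟩
      exact ⟨f, hf, rfl⟩
  refine ⟨fun Δ₁ Δ₂ hΔ ⟨f, hf, hr⟩ => ?_, fun Δ₁ Δ₂ lam h0 h1 ⟨f, hf, hr⟩ ⟨f', hf', hr'⟩ => ?_⟩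
  · rw [hT, hT]
    refine csInf_le_csInf (hbdd Δ₂) ⟨F f, f, hf, hr, rfl⟩ ?_
    rintro _ ⟨k, hk, hkr, rfl⟩
    exact ⟨k, hk, hkr.trans hΔ, rfl⟩
  · have h1' : 0 ≤ 1 - lam := sub_nonneg.2 h1
    refine le_of_forall_pos_le_add fun ε hε => ?_
    obtain ⟨_, ⟨k₁, hk₁, hkr₁, rfl⟩, hlt₁⟩ := Real.lt_sInf_add_pos
      (s := {r : ℝ | ∃ f : 𝒳 → 𝒵 → ℝ, IsKernel f ∧
        risk (jointXZ pSX f) g ℓ ys ≤ Δ₁ ∧ r = F f}) ⟨F f, f, hf, hr, rfl⟩ hε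
    obtain ⟨_, ⟨k₂, hk₂, hkr₂, rfl⟩, hlt₂⟩ := Real.lt_sInf_add_pos
      (s := {r : ℝ | ∃ f : 𝒳 → 𝒵 → ℝ, IsKernel f ∧
        risk (jointXZ pSX f) g ℓ ys ≤ Δ₂ ∧ r = F f}) ⟨F f', f', hf', hr', rfl⟩ hε
    rw [← hT] at hlt₁ hlt₂
    calc T (lam * Δ₁ + (1 - lam) * Δ₂) ≤ F (lam • k₁ + (1 - lam) • k₂) := by
          rw [hT]
          refine csInf_le (hbdd _) ⟨_, hF.1 hk₁ hk₂ h0 h1' (by ring), ?_, rfl⟩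
          rw [risk_jointXZ_mix]
          gcongr
      _ ≤ lam * F k₁ + (1 - lam) * F k₂ := hF.2 hk₁ hk₂ h0 h1' (by ring)
      _ ≤ lam * (T Δ₁ + ε) + (1 - lam) * (T Δ₂ + ε) := by gcongr
      _ = lam * T Δ₁ + (1 - lam) * T Δ₂ + ε := by ring
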